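/- arXiv:0911.4419 — 7 statements merged into one kernel-verified Lean document; each statement's English description precedes it below -/
import Mathlib

section
/- Let H be a separable complex Hilbert space and (φ_θ)_{θ∈Θ} a family of unit vectors in H. If for each θ ∈ Θ there exists c_θ ∈ ℂ with |c_θ| = 1 such that ⟨c_{θ'} φ_{θ'}, c_{θ''} φ_{θ''}⟩ ∈ ℝ for all θ', θ'' ∈ Θ, then there exists a discrete statistic on H (a sequence (e_k) of pairwise orthogonal projections summing strongly to the identity, with distinct real eigenvalues (λ_k)) that is weakly sufficient for (φ_θ)_{θ∈Θ}. -/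
open scoped InnerProductSpace

namespace WeaklySufficient

open InnerProductSpace

variable {H : Type*} [NormedAddCommGroup H] [InnerProductSpace ℂ H]

/-- The Gram–Schmidt process applied to vectors with real pairwise inner products yields vectors
whose inner products with the original set are real. -/
theorem inner_gramSchmidt_im {S : Set H} (hS : ∀ x ∈ S, ∀ y ∈ S, (⟪x, y⟫_ℂ).im = 0)
    {f : ℕ → H} (hf : ∀ n, f n ∈ S) (n : ℕ) :
    ∀ x ∈ S, (⟪gramSchmidt ℂ f n, x⟫_ℂ).im = 0 := by
  induction n using Nat.strong_induction_on with
  | _ n ih =>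
    intro x hx
    have h : f n = gramSchmidt ℂ f n + ∑ i ∈ Finset.Iio n,
        (⟪gramSchmidt ℂ f i, f n⟫_ℂ / ((‖gramSchmidt ℂ f i‖ ^ 2 : ℝ) : ℂ)) •
          gramSchmidt ℂ f i := by
      simpa using gramSchmidt_def'' ℂ f n
    rw [← sub_eq_iff_eq_add] at h
    rw [← h, inner_sub_left, sum_inner, Complex.sub_im, hS _ (hf n) _ hx, Complex.im_sum,
      Finset.sum_eq_zero, sub_zero]
    intro i hi
    have hi' := Finset.mem_Iio.1 hi
    have h1 := ih i hi' x hx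
    have h2 := ih i hi' _ (hf n)
    rw [inner_smul_left, Complex.mul_im, h1, map_div₀, Complex.conj_ofReal,
      Complex.div_ofReal_im, Complex.conj_im, h2]
    simp

theorem inner_gramSchmidtNormed_im {S : Set H} (hS : ∀ x ∈ S, ∀ y ∈ S, (⟪x, y⟫_ℂ).im = 0)
    {f : ℕ → H} (hf : ∀ n, f n ∈ S) (n : ℕ) :
    ∀ x ∈ S, (⟪gramSchmidtNormed ℂ f n, x⟫_ℂ).im = 0 := by
  intro x hx
  rw [gramSchmidtNormed, inner_smul_left]
  simp [← Complex.ofReal_inv, Complex.conj_ofReal,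
    inner_gramSchmidt_im hS hf n x hx]

/-- An orthonormal subset of a separable space is countable. -/
theorem countable_of_orthonormal [TopologicalSpace.SeparableSpace H] {s : Set H}
    (hs : Orthonormal ℂ ((↑) : s → H)) : Countable s := by
  have : SecondCountableTopology H := UniformSpace.secondCountable_of_separable H
  have : DiscreteTopology s := by
    refine DiscreteTopology.of_forall_le_dist (r := 1) one_pos fun x y hxy => ?_
    have h := norm_sub_sq (𝕜 := ℂ) (x : H) (y : H)
    rw [hs.1 x, hs.1 y, hs.2 hxy] at h
    change 1 ≤ dist x y
    rw [Subtype.dist_eq, dist_eq_norm]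
    simp at h
    nlinarith [norm_nonneg ((x : H) - y)]
  exact TopologicalSpace.separableSpace_iff_countable.1 inferInstance

/-- A set with real pairwise inner products admits a Hilbert basis relative to which all its
elements have real coordinates. -/
theorem exists_hilbertBasis_inner_im [CompleteSpace H] [TopologicalSpace.SeparableSpace H]
    {S : Set H} (hne : S.Nonempty) (hS : ∀ x ∈ S, ∀ y ∈ S, (⟪x, y⟫_ℂ).im = 0) :
    ∃ (w : Set H) (b : HilbertBasis w ℂ H), ⇑b = ((↑) : w → H) ∧
      ∀ i, ∀ x ∈ S, (⟪b i, x⟫_ℂ).im = 0 := by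
  have : SecondCountableTopology H := UniformSpace.secondCountable_of_separable H
  have := hne.to_subtype
  obtain ⟨u, hu⟩ := TopologicalSpace.exists_dense_seq S
  let f : ℕ → H := fun n => u n
  have hf : ∀ n, f n ∈ S := fun n => (u n).2
  let g := gramSchmidtNormed ℂ f
  have ho : Orthonormal ℂ ((↑) : Set.range (fun i : {i | g i ≠ 0} => g i) → H) :=
    (gramSchmidtNormed_orthonormal' f).toSubtypeRange
  obtain ⟨w, b, hw, hb⟩ := ho.exists_hilbertBasis_extension
  refine ⟨w, b, hb, fun i x hx => ?_⟩
  by_cases hi : (i : H) ∈ Set.range (fun i : {i | g i ≠ 0} => g i)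
  · obtain ⟨n, hn⟩ := hi
    rw [hb, ← hn]
    exact inner_gramSchmidtNormed_im hS hf n x hx
  · have hg : ∀ n, ⟪b i, g n⟫_ℂ = 0 := by
      intro n
      by_cases hn : g n = 0
      · rw [hn, inner_zero_right]
      · have hmem : g n ∈ Set.range (fun i : {i | g i ≠ 0} => g i) := ⟨⟨n, hn⟩, rfl⟩
        have hne : i ≠ ⟨g n, hw hmem⟩ := fun h => hi (by rw [h]; exact hmem)
        simpa [hb] using b.orthonormal.2 hne
    have hfz : ∀ n, ⟪b i, f n⟫_ℂ = 0 := by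
      intro n
      have hmem : f n ∈ Submodule.span ℂ (Set.range g) := by
        rw [span_gramSchmidtNormed_range, span_gramSchmidt]
        exact Submodule.subset_span ⟨n, rfl⟩
      have hle : Submodule.span ℂ (Set.range g) ≤ (ℂ ∙ b i)ᗮ := by
        rw [Submodule.span_le]
        rintro _ ⟨m, rfl⟩
        exact Submodule.mem_orthogonal_singleton_iff_inner_right.2 (hg m)
      exact Submodule.mem_orthogonal_singleton_iff_inner_right.1 (hle hmem)
    have hall : (fun y : S => ⟪b i, (y : H)⟫_ℂ) = fun _ => 0 :=
      hu.equalizer (by fun_prop) continuous_const (funext hfz)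
    have := congrFun hall ⟨x, hx⟩
    simp only at this
    simp [this]

/-- Sequence version of `exists_hilbertBasis_inner_im`, padded with zero vectors. -/
theorem exists_seq_inner_im [CompleteSpace H] [TopologicalSpace.SeparableSpace H]
    {S : Set H} (hne : S.Nonempty) (hS : ∀ x ∈ S, ∀ y ∈ S, (⟪x, y⟫_ℂ).im = 0) :
    ∃ v : ℕ → H, (∀ k, ‖v k‖ = 1 ∨ v k = 0) ∧ (∀ j k, j ≠ k → ⟪v j, v k⟫_ℂ = 0) ∧
      (∀ ξ, HasSum (fun k => ⟪v k, ξ⟫_ℂ • v k) ξ) ∧ ∀ k, ∀ x ∈ S, (⟪v k, x⟫_ℂ).im = 0 := by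
  obtain ⟨w, b, hb, hreal⟩ := exists_hilbertBasis_inner_im hne hS
  have : Countable w := countable_of_orthonormal (hb ▸ b.orthonormal)
  obtain ⟨ι, hι⟩ := exists_injective_nat w
  let v : ℕ → H := Function.extend ι b 0
  have hv : ∀ i, v (ι i) = b i := fun i => hι.extend_apply _ _ _
  have hv' : ∀ k, k ∉ Set.range ι → v k = 0 := fun k hk => Function.extend_apply' _ _ _ hk
  refine ⟨v, fun k => ?_, fun j k hjk => ?_, fun ξ => ?_, fun k x hx => ?_⟩
  · by_cases hk : k ∈ Set.range ι
    · obtain ⟨i, rfl⟩ := hk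
      exact Or.inl (by rw [hv]; exact b.orthonormal.1 i)
    · exact Or.inr (hv' k hk)
  · by_cases hk : k ∈ Set.range ι
    · by_cases hj : j ∈ Set.range ι
      · obtain ⟨i, rfl⟩ := hk
        obtain ⟨l, rfl⟩ := hj
        rw [hv, hv]
        exact b.orthonormal.2 fun h => hjk (congrArg ι h)
      · rw [hv' j hj, inner_zero_left]
    · rw [hv' k hk, inner_zero_right]
  · rw [← hι.hasSum_iff fun k hk => by rw [hv' k hk, smul_zero]]
    convert b.hasSum_repr ξ using 2 with i
    simp [hv, b.repr_apply_apply]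
  · by_cases hk : k ∈ Set.range ι
    · obtain ⟨i, rfl⟩ := hk
      rw [hv]
      exact hreal i x hx
    · simp [hv' k hk]

end WeaklySufficient

/-- If a family of unit vectors in a separable complex Hilbert space admits
versions with pairwise real inner products, then there exists a discrete statistic
(pairwise orthogonal projections summing strongly to the identity, with distinct real
eigenvalues) that is weakly sufficient for the family. -/
theorem exists_weakly_sufficient_discrete_statistic
    {H : Type*} [NormedAddCommGroup H] [InnerProductSpace ℂ H]
    [CompleteSpace H] [TopologicalSpace.SeparableSpace H]
    {Θ : Type*} (φ : Θ → H) (hφ : ∀ θ, ‖φ θ‖ = 1)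
    (hreal : ∃ c : Θ → ℂ, (∀ θ, ‖c θ‖ = 1) ∧
      ∀ θ' θ'' : Θ, ∃ r : ℝ, ⟪c θ' • φ θ', c θ'' • φ θ''⟫_ℂ = (r : ℂ)) :
    ∃ (e : ℕ → H →L[ℂ] H) (lam : ℕ → ℝ),
      (∀ k, IsSelfAdjoint (e k)) ∧
      (∀ k, e k * e k = e k) ∧
      (∀ j k, j ≠ k → e j * e k = 0) ∧
      (∀ ξ : H, HasSum (fun k => e k ξ) ξ) ∧
      Function.Injective lam ∧
      ∃ (χ : H) (c : Θ → ℂ) (a : Θ → ℕ → ℝ),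
        (∀ θ, ‖c θ‖ = 1) ∧
        ∀ θ, HasSum (fun k => (a θ k : ℂ) • e k χ) (c θ • φ θ) := by
  obtain ⟨c, hc, hr⟩ := hreal
  obtain ⟨v, hv, hvo, hvs, hvr⟩ := WeaklySufficient.exists_seq_inner_im
    (S := insert 0 (Set.range fun θ => c θ • φ θ)) (Set.insert_nonempty _ _) (by
      rintro x (rfl | ⟨θ, rfl⟩) y (rfl | ⟨θ', rfl⟩)
      · simp
      · simp
      · simp
      · obtain ⟨r, h⟩ := hr θ θ'
        simp only [h, Complex.ofReal_im])
  have hnorm : ∀ k, ‖v k‖ ≤ 1 := fun k => by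
    rcases hv k with h | h <;> simp [h]
  have hself : ∀ k, ⟪v k, v k⟫_ℂ • v k = v k := fun k => by
    rcases hv k with h | h
    · rw [inner_self_eq_norm_sq_to_K, h]
      simp
    · simp [h]
  have hsum : Summable fun k => ((1 / 2 : ℂ) ^ k) • v k := by
    refine Summable.of_norm_bounded (g := fun k => (1 / 2 : ℝ) ^ k) summable_geometric_two
      fun k => ?_
    rw [norm_smul, norm_pow]
    have : ‖(1 / 2 : ℂ)‖ = 1 / 2 := by simp
    rw [this]
    exact mul_le_of_le_one_right (by positivity) (hnorm k)
  have hcoord : ∀ k, ⟪v k, ∑' j, ((1 / 2 : ℂ) ^ j) • v j⟫_ℂ • v k = ((1 / 2 : ℂ) ^ k) • v k := by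
    intro k
    have h := (hsum.hasSum.mapL (innerSL ℂ (v k))).unique (hasSum_single k fun j hj => by
      simp [hvo k j hj.symm])
    simp only [innerSL_apply_apply, inner_smul_right] at h
    rw [h, mul_smul, hself]
  refine ⟨fun k => InnerProductSpace.rankOne ℂ (v k) (v k), fun k => k, fun k => ?_, fun k => ?_,
    fun j k hjk => ?_, hvs, Nat.cast_injective, ∑' k, ((1 / 2 : ℂ) ^ k) • v k, c,
    fun θ k => 2 ^ k * (⟪v k, c θ • φ θ⟫_ℂ).re, hc, fun θ => ?_⟩
  · exact (InnerProductSpace.isPositive_rankOne_self (v k)).isSelfAdjoint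
  · ext x
    simp only [mul_apply_eq_comp, InnerProductSpace.rankOne_apply, inner_smul_right]
    rw [mul_smul, hself]
  · ext x
    simp [hvo j k hjk]
  · convert hvs (c θ • φ θ) using 2 with k
    have him : ((⟪v k, c θ • φ θ⟫_ℂ).re : ℂ) = ⟪v k, c θ • φ θ⟫_ℂ :=
      Complex.ext rfl (hvr k _ (Or.inr ⟨θ, rfl⟩)).symm
    rw [InnerProductSpace.rankOne_apply, hcoord, smul_smul, Complex.ofReal_mul, him,
      Complex.ofReal_pow, Complex.ofReal_ofNat, mul_right_comm, ← mul_pow]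
    simp
end

section
/- Let H be a separable complex Hilbert space, (φ_θ)_{θ∈Θ} a family of unit vectors in H, and T = ∑_k λ_k e_k a discrete statistic on H. If T is weakly sufficient for (φ_θ)_{θ∈Θ}, then for each θ ∈ Θ there exists c_θ ∈ ℂ with |c_θ| = 1 such that ⟨c_{θ'} φ_{θ'}, c_{θ''} φ_{θ''}⟩ ∈ ℝ for all θ', θ'' ∈ Θ. -/
open scoped InnerProductSpace

/-- Sums of real multiples of pairwise orthogonal vectors have real inner products. -/
theorem inner_im_eq_zero_of_hasSum_real_smul {ι H : Type*} [NormedAddCommGroup H]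
    [InnerProductSpace ℂ H] {v : ι → H} (hv : Pairwise fun i j => ⟪v i, v j⟫_ℂ = 0)
    {a b : ι → ℝ} {x y : H} (hx : HasSum (fun i => (a i : ℂ) • v i) x)
    (hy : HasSum (fun i => (b i : ℂ) • v i) y) : (⟪x, y⟫_ℂ).im = 0 := by
  have inner_left (i : ι) : ⟪v i, x⟫_ℂ = a i * ⟪v i, v i⟫_ℂ := by
    have h := hx.mapL (innerSL ℂ (v i))
    simp only [innerSL_apply_apply, inner_smul_right] at h
    refine h.unique (hasSum_single i fun j hj => ?_)
    rw [hv hj.symm, mul_zero]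
  have h := Complex.hasSum_im (hy.mapL (innerSL ℂ x))
  refine h.unique (hasSum_zero.congr_fun fun i => ?_)
  rw [innerSL_apply_apply, inner_smul_right, ← inner_conj_symm, inner_left,
    inner_self_eq_norm_sq_to_K]
  simp [← Complex.ofReal_pow]

/-- If a discrete statistic T = ∑ₖ λₖ eₖ is weakly sufficient for a family
of unit vectors, then the family admits versions with pairwise real inner products. -/
theorem real_inner_products_of_weakly_sufficient
    {H : Type*} [NormedAddCommGroup H] [InnerProductSpace ℂ H]
    [CompleteSpace H] [TopologicalSpace.SeparableSpace H]
    {Θ : Type*} (φ : Θ → H) (hφ : ∀ θ, ‖φ θ‖ = 1)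
    (e : ℕ → H →L[ℂ] H) (lam : ℕ → ℝ)
    (hsa : ∀ k, IsSelfAdjoint (e k))
    (hidem : ∀ k, e k * e k = e k)
    (horth : ∀ j k, j ≠ k → e j * e k = 0)
    (hsum : ∀ ξ : H, HasSum (fun k => e k ξ) ξ)
    (hlam : Function.Injective lam)
    (hws : ∃ (χ : H) (c : Θ → ℂ) (a : Θ → ℕ → ℝ),
      (∀ θ, ‖c θ‖ = 1) ∧
      ∀ θ, HasSum (fun k => (a θ k : ℂ) • e k χ) (c θ • φ θ)) :
    ∃ c : Θ → ℂ, (∀ θ, ‖c θ‖ = 1) ∧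
      ∀ θ' θ'' : Θ, ∃ r : ℝ, ⟪c θ' • φ θ', c θ'' • φ θ''⟫_ℂ = (r : ℂ) := by
  obtain ⟨χ, c, a, hc, ha⟩ := hws
  have hv : Pairwise fun j k => ⟪e j χ, e k χ⟫_ℂ = 0 := fun j k hjk => by
    have h : e j (e k χ) = 0 := congrArg (fun f : H →L[ℂ] H => f χ) (horth j k hjk)
    exact ((hsa j).isSymmetric.apply_clm χ (e k χ)).trans (by rw [h, inner_zero_right])
  exact ⟨c, hc, fun θ' θ'' => ⟨_, Complex.ext rfl
    (inner_im_eq_zero_of_hasSum_real_smul hv (ha θ') (ha θ''))⟩⟩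
end

section
/- Let H be a separable complex Hilbert space, (φ_θ)_{θ∈Θ} a family of unit vectors in H, and T = ∑_k λ_k e_k a discrete statistic on H. The following are equivalent: (i) T is weakly sufficient for (φ_θ)_{θ∈Θ}; (ii) for each k, the linear span of {e_k φ_θ : θ ∈ Θ} has dimension 0 or 1, and there exist unimodular scalars (c_θ)_{θ∈Θ} such that ⟨e_k (c_{θ'} φ_{θ'}), c_{θ''} φ_{θ''}⟩ ∈ ℝ for every k and all θ', θ'' ∈ Θ. -/
open scoped InnerProductSpace

/-- If a continuous linear map `p` kills every term of a convergent series except possibly the `j`-th,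
it maps the sum to the image of the `j`-th term. -/
theorem HasSum.apply_eq_of_forall_ne {E F : Type*} [NormedAddCommGroup E] [NormedSpace ℂ E]
    [NormedAddCommGroup F] [NormedSpace ℂ F] {v : ℕ → E} {x : E} (hv : HasSum v x) (p : E →L[ℂ] F)
    (j : ℕ) (h : ∀ k, k ≠ j → p (v k) = 0) : p x = p (v j) :=
  (p.hasSum hv).unique (hasSum_single j h)

/-- If the span of a family `v` has dimension at most one and all inner products of its members are
real, the members are real multiples of a vector in the span of norm at most `ε`. -/
theorem exists_norm_le_forall_eq_real_smul {H Θ : Type*} [NormedAddCommGroup H]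
    [InnerProductSpace ℂ H] (v : Θ → H)
    (hrank : Module.rank ℂ ↥(Submodule.span ℂ (Set.range v)) ≤ 1)
    (hreal : ∀ θ θ', ∃ r : ℝ, ⟪v θ, v θ'⟫_ℂ = (r : ℂ)) {ε : ℝ} (hε : 0 < ε) :
    ∃ x ∈ Submodule.span ℂ (Set.range v), ‖x‖ ≤ ε ∧ ∃ a : Θ → ℝ, ∀ θ, v θ = (a θ : ℂ) • x := by
  by_cases hzero : ∀ θ, v θ = 0
  · exact ⟨0, Submodule.zero_mem _, by simpa using hε.le, fun _ => 0, fun θ => by simp [hzero θ]⟩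
  push Not at hzero
  obtain ⟨θ₀, h₀⟩ := hzero
  have hn : ‖v θ₀‖ ≠ 0 := norm_ne_zero_iff.2 h₀
  obtain ⟨w, -, hw⟩ := (rank_submodule_le_one_iff _).1 hrank
  have hmul : ∀ θ, ∃ z : ℂ, z • w = v θ := fun θ =>
    Submodule.mem_span_singleton.1 (hw (Submodule.subset_span ⟨θ, rfl⟩))
  obtain ⟨β, hβ⟩ := hmul θ₀
  have hβ0 : β ≠ 0 := by
    rintro rfl
    exact h₀ (by rw [← hβ, zero_smul])
  have key : ∀ θ, ∃ r : ℝ, v θ = (r : ℂ) • v θ₀ := by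
    intro θ
    obtain ⟨α, hα⟩ := hmul θ
    obtain ⟨r, hr⟩ := hreal θ₀ θ
    have hz : v θ = (α / β) • v θ₀ := by
      rw [← hβ, smul_smul, div_mul_cancel₀ _ hβ0, hα]
    refine ⟨r / ‖v θ₀‖ ^ 2, ?_⟩
    rw [hz, inner_smul_right, inner_self_eq_norm_sq_to_K] at hr
    have hn' : ((‖v θ₀‖ : ℝ) : ℂ) ≠ 0 := by exact_mod_cast hn
    rw [hz]
    congr 1
    push_cast
    rw [← hr]
    exact (mul_div_cancel_right₀ _ (pow_ne_zero 2 hn')).symm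
  choose r hr using key
  refine ⟨((ε / ‖v θ₀‖ : ℝ) : ℂ) • v θ₀, Submodule.smul_mem _ _ (Submodule.subset_span ⟨θ₀, rfl⟩),
    ?_, fun θ => r θ * (‖v θ₀‖ / ε), fun θ => ?_⟩
  · rw [norm_smul, Complex.norm_real, Real.norm_of_nonneg (by positivity), div_mul_cancel₀ _ hn]
  · rw [smul_smul, ← Complex.ofReal_mul, mul_assoc, div_mul_div_cancel₀ hε.ne', div_self hn,
      mul_one]
    exact hr θ

/-- A discrete statistic T = ∑ₖ λₖ eₖ is weakly sufficient for a family of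
unit vectors (φ_θ) iff for each k the span of {eₖ φ_θ} has dimension 0 or 1, and there
are versions of the φ_θ making all the quantities ⟨eₖ φ_θ', φ_θ''⟩ real. -/
theorem weakly_sufficient_iff_discrete
    {H : Type*} [NormedAddCommGroup H] [InnerProductSpace ℂ H]
    [CompleteSpace H] [TopologicalSpace.SeparableSpace H]
    {Θ : Type*} (φ : Θ → H) (hφ : ∀ θ, ‖φ θ‖ = 1)
    (e : ℕ → H →L[ℂ] H) (lam : ℕ → ℝ)
    (hsa : ∀ k, IsSelfAdjoint (e k))
    (hidem : ∀ k, e k * e k = e k)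
    (horth : ∀ j k, j ≠ k → e j * e k = 0)
    (hsum : ∀ ξ : H, HasSum (fun k => e k ξ) ξ)
    (hlam : Function.Injective lam) :
    (∃ (χ : H) (c : Θ → ℂ) (a : Θ → ℕ → ℝ),
      (∀ θ, ‖c θ‖ = 1) ∧
      ∀ θ, HasSum (fun k => (a θ k : ℂ) • e k χ) (c θ • φ θ)) ↔
    ((∀ k, Module.rank ℂ ↥(Submodule.span ℂ (Set.range fun θ => e k (φ θ))) ≤ 1) ∧
      ∃ c : Θ → ℂ, (∀ θ, ‖c θ‖ = 1) ∧
        ∀ (k : ℕ) (θ' θ'' : Θ), ∃ r : ℝ,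
          ⟪e k (c θ' • φ θ'), c θ'' • φ θ''⟫_ℂ = (r : ℂ)) := by
  have hne : ∀ θ (c : Θ → ℂ), (∀ θ, ‖c θ‖ = 1) → c θ ≠ 0 := fun θ c hc =>
    norm_ne_zero_iff.1 (by simp [hc θ])
  have happ : ∀ k x, e k (e k x) = e k x := fun k x => DFunLike.congr_fun (hidem k) x
  have happ0 : ∀ j k x, j ≠ k → e j (e k x) = 0 := fun j k x h =>
    DFunLike.congr_fun (horth j k h) x
  have hinner : ∀ k x y, ⟪e k x, y⟫_ℂ = ⟪e k x, e k y⟫_ℂ := fun k x y => by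
    have h : ⟪e k (e k x), y⟫_ℂ = ⟪e k x, e k y⟫_ℂ := (hsa k).isSymmetric (e k x) y
    rwa [happ] at h
  constructor
  · rintro ⟨χ, c, a, hc, ha⟩
    have hcomp : ∀ θ k, e k (c θ • φ θ) = (a θ k : ℂ) • e k χ := fun θ k => by
      rw [(ha θ).apply_eq_of_forall_ne (e k) k
        fun j hj => by rw [map_smul, happ0 k j χ hj.symm, smul_zero], map_smul, happ]
    refine ⟨fun k => ?_, c, hc, fun k θ' θ'' => ?_⟩
    · refine (rank_submodule_le_one_iff' _).2 ⟨e k χ, Submodule.span_le.2 ?_⟩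
      rintro _ ⟨θ, rfl⟩
      have h := hcomp θ k
      rw [map_smul] at h
      exact Submodule.mem_span_singleton.2 ⟨(c θ)⁻¹ * a θ k, by
        rw [mul_smul, ← h, inv_smul_smul₀ (hne θ c hc)]⟩
    · refine ⟨a θ' k * (a θ'' k * ‖e k χ‖ ^ 2), ?_⟩
      rw [hinner, hcomp, hcomp, inner_smul_left, inner_smul_right, inner_self_eq_norm_sq_to_K]
      simp
  · rintro ⟨hrank, c, hc, hreal⟩
    have hspan : ∀ k, Submodule.span ℂ (Set.range fun θ => e k (c θ • φ θ)) ≤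
        Submodule.span ℂ (Set.range fun θ => e k (φ θ)) := fun k => by
      refine Submodule.span_le.2 ?_
      rintro _ ⟨θ, rfl⟩
      simp only [map_smul]
      exact Submodule.smul_mem _ _ (Submodule.subset_span ⟨θ, rfl⟩)
    choose x hx hnorm a ha using fun k => exists_norm_le_forall_eq_real_smul
      (fun θ => e k (c θ • φ θ)) ((Submodule.rank_mono (hspan k)).trans (hrank k))
      (fun θ θ' => (hreal k θ θ').imp fun _ hr => (hinner k _ _).symm.trans hr)
      (ε := (1 / 2 : ℝ) ^ k) (by positivity)
    have hfix : ∀ k, e k (x k) = x k := fun k => by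
      have h : Submodule.span ℂ (Set.range fun θ => e k (c θ • φ θ)) ≤
          LinearMap.range (e k).toLinearMap := by
        refine Submodule.span_le.2 ?_
        rintro _ ⟨θ, rfl⟩
        exact ⟨_, rfl⟩
      obtain ⟨y, hy⟩ := h (hx k)
      rw [← hy]
      exact happ k y
    have hχ : HasSum x (∑' k, x k) :=
      (Summable.of_norm_bounded summable_geometric_two hnorm).hasSum
    have hcomp : ∀ k, e k (∑' j, x j) = x k := fun k => by
      rw [hχ.apply_eq_of_forall_ne (e k) k
        fun j hj => by rw [← hfix j, happ0 k j _ hj.symm], hfix]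
    refine ⟨∑' k, x k, c, fun θ k => a k θ, hc, fun θ => ?_⟩
    simpa only [hcomp, ← ha] using hsum (c θ • φ θ)
end

section
/- Let H be a separable complex Hilbert space and T = ∑_k λ_k e_k a discrete statistic that is weakly sufficient for a family (φ_θ)_{θ∈Θ} of unit vectors, so that for each k there are a function γ_k : Θ → ℂ and a unit vector ξ_k with e_k φ_θ = γ_k(θ) ξ_k for all θ. Define j ∼ m iff there exists β ∈ ℂ, β ≠ 0, with γ_j(θ) = β γ_m(θ) for all θ ∈ Θ. Let (𝕀_k) be a partition of ℕ into nonempty pairwise disjoint sets, (β_k) distinct real numbers, f_k = ∑_{j∈𝕀_k} e_j, and U = ∑_k β_k f_k (a coarse-graining Φ(T) of T). Then U is weakly sufficient for (φ_θ)_{θ∈Θ} if and only if for each k and all j, m ∈ 𝕀_k such that γ_j and γ_m are not identically zero, one has j ∼ m. -/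
open scoped InnerProductSpace

section OrthogonalProjections

variable {H : Type*} [NormedAddCommGroup H] [InnerProductSpace ℂ H] {e : ℕ → H →L[ℂ] H}

/-- Applying one of a family of mutually orthogonal projections to a sum of vectors, each
absorbed by the projection with the same index, extracts the corresponding term. -/
lemma apply_eq_of_hasSum (hidem : ∀ k, e k * e k = e k)
    (horth : ∀ j k, j ≠ k → e j * e k = 0) {a : ℕ → ℂ} {u : ℕ → H} {x : H}
    (h : HasSum (fun k => a k • e k (u k)) x) (j : ℕ) : e j x = a j • e j (u j) := by
  have h₁ : HasSum (fun k => e j (a k • e k (u k))) (e j x) := (e j).hasSum h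
  have h₂ := hasSum_single (f := fun k => e j (a k • e k (u k))) j (fun k hk => by
    have := DFunLike.congr_fun (horth j k hk.symm) (u k)
    simp_all)
  rw [h₁.unique h₂, map_smul]
  exact congrArg _ (DFunLike.congr_fun (hidem j) (u j))

/-- The part of a vector supported on a set of indices. -/
lemma exists_apply_eq_indicator [CompleteSpace H] (hidem : ∀ k, e k * e k = e k)
    (horth : ∀ j k, j ≠ k → e j * e k = 0) (hsum : ∀ x : H, HasSum (fun k => e k x) x)
    (s : Set ℕ) (x : H) :
    ∃ y, (∀ j ∈ s, e j y = e j x) ∧ ∀ j ∉ s, e j y = 0 := by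
  classical
  have h := ((hsum x).summable.indicator s).hasSum
  have h' : HasSum (fun k => (if k ∈ s then 1 else 0 : ℂ) • e k x)
      (∑' k, s.indicator (fun k => e k x) k) := by
    convert h using 2 with k
    by_cases hk : k ∈ s <;> simp [hk]
  refine ⟨∑' k, s.indicator (fun k => e k x) k, fun j hj => ?_, fun j hj => ?_⟩
  · simpa [hj] using apply_eq_of_hasSum hidem horth (u := fun _ => x) h' j
  · simpa [hj] using apply_eq_of_hasSum hidem horth (u := fun _ => x) h' j

/-- Vectors with disjoint supports can be rescaled and glued into a single vector. -/
lemma exists_apply_eq_smul [CompleteSpace H] (κ : ℕ → ℕ) (v : ℕ → H)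
    (hv : ∀ k j, κ j ≠ k → e j (v k) = 0) :
    ∃ (x : H) (s : ℕ → ℝ), (∀ k, s k ≠ 0) ∧ ∀ j, e j x = (s (κ j) : ℂ) • e j (v (κ j)) := by
  let s : ℕ → ℝ := fun k => (1 / 2) ^ k / (1 + ‖v k‖)
  have hpos : ∀ k, 0 < s k := fun k => by positivity
  have hsm : Summable (fun k => (s k : ℂ) • v k) := by
    refine Summable.of_norm_bounded summable_geometric_two (fun k => ?_)
    rw [norm_smul, Complex.norm_real, Real.norm_of_nonneg (hpos k).le, div_mul_eq_mul_div,
      div_le_iff₀ (by positivity)]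
    gcongr
    simp
  refine ⟨∑' k, (s k : ℂ) • v k, s, fun k => (hpos k).ne', fun j => ?_⟩
  have h₁ : HasSum (fun k => e j ((s k : ℂ) • v k)) _ := (e j).hasSum hsm.hasSum
  have h₂ := hasSum_single (f := fun k => e j ((s k : ℂ) • v k)) (κ j) (fun k hk => by
    simp [hv k j hk.symm])
  rw [h₁.unique h₂, map_smul]

end OrthogonalProjections

/-- Let T = ∑ₖ λₖ eₖ be a discrete statistic weakly sufficient for (φ_θ),
so that eₖ φ_θ = γₖ(θ) ξₖ for unit vectors ξₖ.  Encode a partition (𝕀ₖ) of ℕ into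
nonempty pairwise disjoint sets by a surjection κ : ℕ → ℕ (𝕀ₖ = κ⁻¹{k}), and let
(βₖ) be distinct reals.  The coarse-graining U = ∑ₖ βₖ fₖ, fₖ = ∑_{j ∈ 𝕀ₖ} eⱼ, is
weakly sufficient iff for each k all j, m ∈ 𝕀ₖ with γⱼ, γₘ not identically zero satisfy
j ∼ m, i.e. γⱼ = β'·γₘ for some β' ≠ 0. -/
theorem coarse_graining_weakly_sufficient_iff
    {H : Type*} [NormedAddCommGroup H] [InnerProductSpace ℂ H]
    [CompleteSpace H] [TopologicalSpace.SeparableSpace H]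
    {Θ : Type*} (φ : Θ → H) (hφ : ∀ θ, ‖φ θ‖ = 1)
    (e : ℕ → H →L[ℂ] H) (lam : ℕ → ℝ)
    (hsa : ∀ k, IsSelfAdjoint (e k))
    (hidem : ∀ k, e k * e k = e k)
    (horth : ∀ j k, j ≠ k → e j * e k = 0)
    (hsum : ∀ ξ : H, HasSum (fun k => e k ξ) ξ)
    (hlam : Function.Injective lam)
    (hT : ∃ (χ : H) (c : Θ → ℂ) (a : Θ → ℕ → ℝ),
      (∀ θ, ‖c θ‖ = 1) ∧
      ∀ θ, HasSum (fun k => (a θ k : ℂ) • e k χ) (c θ • φ θ))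
    (γ : ℕ → Θ → ℂ) (ξ : ℕ → H) (hξ : ∀ k, ‖ξ k‖ = 1)
    (hγ : ∀ k θ, e k (φ θ) = γ k θ • ξ k)
    (κ : ℕ → ℕ) (hκ : Function.Surjective κ)
    (β : ℕ → ℝ) (hβ : Function.Injective β) :
    (∃ (χ : H) (c : Θ → ℂ) (b : Θ → ℕ → ℝ),
      (∀ θ, ‖c θ‖ = 1) ∧
      ∀ θ, HasSum (fun j => (b θ (κ j) : ℂ) • e j χ) (c θ • φ θ)) ↔
    (∀ j m, κ j = κ m → (∃ θ, γ j θ ≠ 0) → (∃ θ, γ m θ ≠ 0) →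
      ∃ β' : ℂ, β' ≠ 0 ∧ ∀ θ, γ j θ = β' * γ m θ) := by
  have hξ0 : ∀ k, ξ k ≠ 0 := fun k h => by simpa [h] using hξ k
  constructor
  · rintro ⟨χ, c, b, hc, hb⟩ j m hjm ⟨θj, hj⟩ ⟨θm, hm⟩
    have hc0 : ∀ θ, c θ ≠ 0 := fun θ h => by simpa [h] using hc θ
    have key : ∀ i θ, (c θ * γ i θ) • ξ i = (b θ (κ i) : ℂ) • e i χ := fun i θ => by
      rw [← apply_eq_of_hasSum hidem horth (u := fun _ => χ) (hb θ) i, map_smul, hγ, smul_smul]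
    have hη : ∀ i θ, γ i θ ≠ 0 →
        ∃ η : ℂ, η ≠ 0 ∧ ∀ θ', c θ' * γ i θ' = b θ' (κ i) * η := fun i θ h => by
      have hb0 : (b θ (κ i) : ℂ) ≠ 0 := fun h0 => by
        have := key i θ
        simp [h0, hc0, h, hξ0] at this
      refine ⟨(b θ (κ i) : ℂ)⁻¹ * (c θ * γ i θ),
        mul_ne_zero (inv_ne_zero hb0) (mul_ne_zero (hc0 θ) h), fun θ' => ?_⟩
      apply smul_left_injective ℂ (hξ0 i)
      simp only [key i θ', mul_smul _ (_ * _), key i θ, inv_smul_smul₀ hb0]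
    obtain ⟨ηj, hηj, hj⟩ := hη j θj hj
    obtain ⟨ηm, hηm, hm⟩ := hη m θm hm
    refine ⟨ηj / ηm, div_ne_zero hηj hηm, fun θ => mul_left_cancel₀ (hc0 θ) ?_⟩
    rw [mul_left_comm, hj, hm, hjm]
    field_simp
  · intro hequiv
    obtain ⟨χ, c, a, hc, ha⟩ := hT
    have hc0 : ∀ θ, c θ ≠ 0 := fun θ h => by simpa [h] using hc θ
    have key : ∀ i θ, (c θ * γ i θ) • ξ i = (a θ i : ℂ) • e i χ := fun i θ => by
      rw [← apply_eq_of_hasSum hidem horth (u := fun _ => χ) (ha θ) i, map_smul, hγ, smul_smul]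
    have hblock : ∀ k, ∃ (v : H) (b : Θ → ℝ), (∀ j, κ j ≠ k → e j v = 0) ∧
        ∀ j, κ j = k → ∀ θ, (b θ : ℂ) • e j v = e j (c θ • φ θ) := fun k => by
      by_cases hk : ∃ m θ, κ m = k ∧ γ m θ ≠ 0
      · obtain ⟨m, θ₀, rfl, hm⟩ := hk
        obtain ⟨v, hv, hv'⟩ := exists_apply_eq_indicator hidem horth hsum {j | κ j = κ m}
          (c θ₀ • φ θ₀)
        refine ⟨v, fun θ => a θ m / a θ₀ m, hv', fun j hj θ => ?_⟩
        have ha0 : (a θ₀ m : ℂ) ≠ 0 := fun h0 => by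
          have := key m θ₀
          simp [h0, hc0, hm, hξ0] at this
        have hcross : (a θ m : ℂ) * (c θ₀ * γ m θ₀) = a θ₀ m * (c θ * γ m θ) := by
          apply smul_left_injective ℂ (hξ0 m)
          simp only [mul_smul _ (_ * _), key]
          exact smul_comm _ _ _
        rw [hv j hj, map_smul, map_smul, hγ, hγ]
        by_cases hj0 : ∃ θ', γ j θ' ≠ 0
        · obtain ⟨β', -, hβ'⟩ := hequiv j m hj hj0 ⟨θ₀, hm⟩
          simp only [smul_smul, hβ']
          congr 1
          push_cast
          field_simp
          linear_combination β' * hcross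
        · push Not at hj0
          simp [hj0]
      · push Not at hk
        exact ⟨0, 0, by simp, fun j hj θ => by simp [hγ, hk j θ hj]⟩
    choose v b hv hb using hblock
    obtain ⟨x, s, hs, hx⟩ := exists_apply_eq_smul κ v hv
    refine ⟨x, c, fun θ k => b k θ / s k, hc, fun θ => ?_⟩
    convert hsum (c θ • φ θ) using 2 with j
    rw [hx, smul_smul, ← hb (κ j) j rfl θ]
    congr 1
    have : (s (κ j) : ℂ) ≠ 0 := by exact_mod_cast hs (κ j)
    push_cast
    field_simp
end

section
/- Let H be a separable complex Hilbert space and T = ∑_k λ_k e_k a discrete statistic weakly sufficient for a nontrivial family (φ_θ)_{θ∈Θ} of unit vectors (nontrivial means the linear span of {φ_θ : θ ∈ Θ} has dimension at least 2). For g : ℕ → ℝ, let S_g = ∑_k g(k) e_k denote the statistic affiliated with the algebra generated by T determined by g; S_g is weakly sufficient iff there exist χ ∈ H, unimodular scalars (c_θ), and functions Ψ_θ : ℝ → ℝ with ∑_k Ψ_θ(g(k)) e_k χ = c_θ φ_θ for all θ. Then the following are equivalent: (a) there exists s : ℕ → ℝ such that S_s is weakly sufficient and for every g : ℕ → ℝ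 with S_g weakly sufficient there is a function Ψ : ℝ → ℝ with s(k) = Ψ(g(k)) for all k (i.e., S_s is a minimal weakly sufficient statistic with respect to T); (b) for each k, the linear span of {e_k φ_θ : θ ∈ Θ} has dimension exactly 1 (equivalently, for each k there is θ with e_k φ_θ ≠ 0). -/
open scoped InnerProductSpace

section OrthogonalFamily

variable {H : Type*} [NormedAddCommGroup H] [InnerProductSpace ℂ H] {e : ℕ → H →L[ℂ] H}

/-- Applying one projection of an orthogonal family to a sum of vectors lying in the ranges of the
family extracts the corresponding term. -/
theorem apply_eq_of_hasSum_orthogonal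
    (hidem : ∀ k, e k * e k = e k) (horth : ∀ j k, j ≠ k → e j * e k = 0)
    {v : ℕ → H} {y : H} (h : HasSum (fun k => e k (v k)) y) (j : ℕ) :
    e j y = e j (v j) := by
  have h1 : HasSum (fun k => e j (e k (v k))) (e j y) := (e j).hasSum h
  have h2 : HasSum (fun k => e j (e k (v k))) (e j (e j (v j))) :=
    hasSum_single j fun k hk => by
      simpa using congrArg (fun f : H →L[ℂ] H => f (v k)) (horth j k hk.symm)
  rw [h1.unique h2]
  simpa using congrArg (fun f : H →L[ℂ] H => f (v j)) (hidem j)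

theorem hasSum_smul_apply_iff
    (hidem : ∀ k, e k * e k = e k) (horth : ∀ j k, j ≠ k → e j * e k = 0)
    (hsum : ∀ ξ : H, HasSum (fun k => e k ξ) ξ) {b : ℕ → ℂ} {χ y : H} :
    HasSum (fun k => b k • e k χ) y ↔ ∀ k, e k y = b k • e k χ := by
  constructor
  · intro h k
    have h' : HasSum (fun k => e k (b k • χ)) y := by simpa using h
    simpa using apply_eq_of_hasSum_orthogonal hidem horth h' k
  · intro h
    simpa only [h] using hsum y

/-- Given countably many vectors and a partition of the projections, there is a vector whose
component in the `k`-th range is a positive multiple, constant on each cell of the partition, of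
the component of the vector attached to the cell of `k`. -/
theorem exists_glued_vector [CompleteSpace H]
    (hidem : ∀ k, e k * e k = e k) (horth : ∀ j k, j ≠ k → e j * e k = 0)
    (hsum : ∀ ξ : H, HasSum (fun k => e k ξ) ξ) (m : ℕ → ℕ) (v : ℕ → H) :
    ∃ (χ : H) (t : ℕ → ℝ), (∀ i, 0 < t i) ∧ ∀ k, e k χ = (t (m k) : ℂ) • e k (v (m k)) := by
  classical
  let w : ℕ → ℕ → H := fun i k => if m k = i then v i else 0
  have hw : ∀ i, Summable fun k => e k (w i k) := fun i => by
    have h := (hsum (v i)).summable.indicator {k | m k = i}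
    refine h.congr fun k => ?_
    by_cases hk : m k = i <;> simp [w, hk, Set.indicator]
  choose ψ hψ using hw
  have hψe : ∀ i k, e k (ψ i) = if m k = i then e k (v i) else 0 := fun i k => by
    rw [apply_eq_of_hasSum_orthogonal hidem horth (hψ i) k]
    by_cases hk : m k = i <;> simp [w, hk]
  let t : ℕ → ℝ := fun i => (1 / 2) ^ i / (1 + ‖ψ i‖)
  have ht : ∀ i, 0 < t i := fun i => by positivity
  have hts : Summable fun i => (t i : ℂ) • ψ i := by
    refine Summable.of_norm_bounded summable_geometric_two fun i => ?_
    rw [norm_smul, Complex.norm_real, Real.norm_of_nonneg (ht i).le, div_mul_eq_mul_div]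
    rw [div_le_iff₀ (by positivity)]
    gcongr
    linarith
  obtain ⟨χ, hχ⟩ := hts
  refine ⟨χ, t, ht, fun k => ((e k).hasSum hχ).unique ?_⟩
  have h := hasSum_single (f := fun i => e k ((t i : ℂ) • ψ i)) (m k) fun i hi => by
    simp [hψe, Ne.symm hi]
  simpa [hψe] using h

end OrthogonalFamily

theorem rank_span_range_eq_one_iff {K V ι : Type*} [Field K] [AddCommGroup V] [Module K V]
    {f : ι → V} {x : V} (hf : ∀ i, ∃ r : K, f i = r • x) :
    Module.rank K ↥(Submodule.span K (Set.range f)) = 1 ↔ ∃ i, f i ≠ 0 := by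
  constructor
  · intro h
    by_contra! h0
    have hbot : Submodule.span K (Set.range f) = ⊥ := by
      rw [Submodule.span_eq_bot]
      rintro _ ⟨i, rfl⟩
      exact h0 i
    rw [hbot, rank_bot] at h
    exact zero_ne_one h
  · rintro ⟨i, hi⟩
    refine rank_submodule_eq_one_iff _ |>.2
      ⟨f i, Submodule.subset_span ⟨i, rfl⟩, hi, Submodule.span_le.2 ?_⟩
    rintro _ ⟨j, rfl⟩
    obtain ⟨r, hr⟩ := hf i
    obtain ⟨q, hq⟩ := hf j
    have hr0 : r ≠ 0 := by
      rintro rfl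
      simp [hr] at hi
    refine Submodule.mem_span_singleton.2 ⟨q * r⁻¹, ?_⟩
    rw [hr, hq, smul_smul, mul_assoc, inv_mul_cancel₀ hr0, mul_one]

/-- Two indices are related when the corresponding columns of `a` are proportional. -/
def columnSetoid {Θ : Type*} (a : Θ → ℕ → ℝ) : Setoid ℕ where
  r j k := ∃ r : ℝ, r ≠ 0 ∧ ∀ θ, a θ j = r * a θ k
  iseqv :=
    { refl := fun _ => ⟨1, one_ne_zero, fun _ => (one_mul _).symm⟩
      symm := by
        rintro j k ⟨r, hr, h⟩
        exact ⟨r⁻¹, inv_ne_zero hr, fun θ => by rw [h, inv_mul_cancel_left₀ hr]⟩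
      trans := by
        rintro i j k ⟨r, hr, h⟩ ⟨q, hq, h'⟩
        exact ⟨r * q, mul_ne_zero hr hq, fun θ => by rw [h, h', mul_assoc]⟩ }

/-- For a discrete statistic T = ∑ₖ λₖ eₖ weakly sufficient for a nontrivial
family (φ_θ) of unit vectors, there exists a weakly sufficient statistic minimal with
respect to T iff for each k the span of {eₖ φ_θ : θ} is exactly one-dimensional.
Statistics affiliated with the algebra generated by T are S_g = ∑ₖ g(k) eₖ for
g : ℕ → ℝ; S_g is weakly sufficient iff there are χ, unimodular (c_θ) and functions
Ψ_θ : ℝ → ℝ with ∑ₖ Ψ_θ(g(k)) eₖ χ = c_θ φ_θ. -/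
theorem exists_minimal_weakly_sufficient_iff
    {H : Type*} [NormedAddCommGroup H] [InnerProductSpace ℂ H]
    [CompleteSpace H] [TopologicalSpace.SeparableSpace H]
    {Θ : Type*} (φ : Θ → H) (hφ : ∀ θ, ‖φ θ‖ = 1)
    (hnontriv : 2 ≤ Module.rank ℂ ↥(Submodule.span ℂ (Set.range φ)))
    (e : ℕ → H →L[ℂ] H) (lam : ℕ → ℝ)
    (hsa : ∀ k, IsSelfAdjoint (e k))
    (hidem : ∀ k, e k * e k = e k)
    (horth : ∀ j k, j ≠ k → e j * e k = 0)
    (hsum : ∀ ξ : H, HasSum (fun k => e k ξ) ξ)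
    (hlam : Function.Injective lam)
    (hT : ∃ (χ : H) (c : Θ → ℂ) (a : Θ → ℕ → ℝ),
      (∀ θ, ‖c θ‖ = 1) ∧
      ∀ θ, HasSum (fun k => (a θ k : ℂ) • e k χ) (c θ • φ θ)) :
    (∃ s : ℕ → ℝ,
      (∃ (χ : H) (c : Θ → ℂ) (Ψ : Θ → ℝ → ℝ),
        (∀ θ, ‖c θ‖ = 1) ∧
        ∀ θ, HasSum (fun k => (Ψ θ (s k) : ℂ) • e k χ) (c θ • φ θ)) ∧
      ∀ g : ℕ → ℝ,
        (∃ (χ : H) (c : Θ → ℂ) (Ψ : Θ → ℝ → ℝ),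
          (∀ θ, ‖c θ‖ = 1) ∧
          ∀ θ, HasSum (fun k => (Ψ θ (g k) : ℂ) • e k χ) (c θ • φ θ)) →
        ∃ Ψ' : ℝ → ℝ, ∀ k, s k = Ψ' (g k)) ↔
    (∀ k, Module.rank ℂ ↥(Submodule.span ℂ (Set.range fun θ => e k (φ θ))) = 1) := by
  simp only [hasSum_smul_apply_iff hidem horth hsum, map_smul] at hT ⊢
  obtain ⟨χ, c, a, hc, ha⟩ := hT
  have hc0 : ∀ θ, c θ ≠ 0 := fun θ h => by simpa [h] using hc θ
  have ha' : ∀ θ k, e k (φ θ) = ((c θ)⁻¹ * a θ k) • e k χ := fun θ k => by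
    rw [mul_smul, ← ha, inv_smul_smul₀ (hc0 θ)]
  simp only [fun k => rank_span_range_eq_one_iff (K := ℂ) fun θ => ⟨_, ha' θ k⟩]
  constructor
  · rintro ⟨s, ⟨χs, cs, Ψs, hcs, hs⟩, hmin⟩ k₀
    by_contra! hk₀
    have hconst : ∀ k, s k₀ = s k := by
      intro k
      have hfactor := hmin (Function.update lam k₀ (lam k))
        ⟨χ - e k₀ χ, c, fun θ => Function.extend lam (a θ) 0, hc, fun θ j => by
          by_cases hj : j = k₀
          · subst hj
            have : e j (e j χ) = e j χ := congrArg (fun f : H →L[ℂ] H => f χ) (hidem j)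
            simp [hk₀, this]
          · have : e j (e k₀ χ) = 0 := congrArg (fun f : H →L[ℂ] H => f χ) (horth j k₀ hj)
            dsimp only
            rw [Function.update_of_ne hj, hlam.extend_apply, map_sub, this, sub_zero, ha]⟩
      obtain ⟨Ψ', hΨ'⟩ := hfactor
      by_cases hk : k = k₀
      · rw [hk]
      · rw [hΨ', hΨ' k, Function.update_self, Function.update_of_ne hk]
    have hmem : ∀ θ, φ θ ∈ Submodule.span ℂ {χs} := by
      intro θ
      have h : HasSum (fun k => (Ψs θ (s k₀) : ℂ) • e k χs) (cs θ • φ θ) :=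
        (hasSum_smul_apply_iff hidem horth hsum).2 fun k => by
          rw [map_smul, hs, hconst k]
      have hcs0 : cs θ ≠ 0 := fun h => by simpa [h] using hcs θ
      refine (Submodule.smul_mem_iff _ hcs0).1 ?_
      rw [h.unique ((hsum χs).const_smul _)]
      exact Submodule.smul_mem _ _ (Submodule.mem_span_singleton_self χs)
    have hle : Submodule.span ℂ (Set.range φ) ≤ Submodule.span ℂ {χs} :=
      Submodule.span_le.2 (Set.range_subset_iff.2 hmem)
    have hrank : Module.rank ℂ ↥(Submodule.span ℂ {χs}) ≤ 1 := by
      simpa using rank_span_le (R := ℂ) {χs}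
    exact absurd (hnontriv.trans ((Submodule.rank_mono hle).trans hrank)) (by norm_num)
  · intro hb
    choose τ hτ using hb
    have hχ0 : ∀ k, e k χ ≠ 0 := fun k h => hτ k (by rw [ha', h, smul_zero])
    have hτ0 : ∀ k, a (τ k) k ≠ 0 := fun k h => hτ k (by rw [ha', h]; simp)
    let m : ℕ → ℕ := fun k => (Quotient.mk (columnSetoid a) k).out
    have hm : ∀ k, ∃ r : ℝ, r ≠ 0 ∧ ∀ θ, a θ k = r * a θ (m k) := fun k =>
      (columnSetoid a).symm (Quotient.mk_out (s := columnSetoid a) k)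
    refine ⟨fun k => m k, ?_, ?_⟩
    · obtain ⟨χ', t, ht, hχ'⟩ := exists_glued_vector hidem horth hsum m
        fun i => c (τ i) • φ (τ i)
      refine ⟨χ', c, fun θ x => a θ ⌊x⌋₊ / (a (τ ⌊x⌋₊) ⌊x⌋₊ * t ⌊x⌋₊), hc, fun θ k => ?_⟩
      obtain ⟨r, hr, hrk⟩ := hm k
      have h1 : (a (τ (m k)) (m k) : ℂ) ≠ 0 := by exact_mod_cast hτ0 (m k)
      have h2 : (t (m k) : ℂ) ≠ 0 := by exact_mod_cast (ht (m k)).ne'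
      dsimp only
      rw [hχ', map_smul, ha, ha, smul_smul, smul_smul, Nat.floor_natCast, hrk θ, hrk (τ (m k))]
      congr 1
      push_cast
      field_simp
    · rintro g ⟨χ', c', p, hc', hp⟩
      have hfac : Function.FactorsThrough (fun k => (m k : ℝ)) g := by
        intro j k hjk
        have hc'0 : ∀ θ, c' θ ≠ 0 := fun θ h => by simpa [h] using hc' θ
        have hp0 : (p (τ j) (g j) : ℂ) ≠ 0 := fun h => by
          have := hp (τ j) j
          rw [h, zero_smul] at this
          exact smul_ne_zero (hc'0 _) (hτ j) this
        have key : ∀ θ i, g i = g j →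
            (a θ i : ℂ) = p θ (g j) / p (τ j) (g j) * (c' (τ j) * c θ) / (c (τ j) * c' θ)
              * a (τ j) i := by
          intro θ i hi
          have h1 := hp θ i
          have h2 := hp (τ j) i
          rw [ha', hi, smul_smul] at h1 h2
          have h3 : (p (τ j) (g j) * (c' θ * ((c θ)⁻¹ * a θ i)) : ℂ) • e i χ
              = (p θ (g j) * (c' (τ j) * ((c (τ j))⁻¹ * a (τ j) i)) : ℂ) • e i χ := by
            rw [mul_smul, h1, mul_smul (p θ (g j) : ℂ), h2, smul_comm]
          have h4 := smul_left_injective ℂ (hχ0 i) h3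
          have := hc0 θ
          have := hc0 (τ j)
          have := hc'0 θ
          field_simp at h4 ⊢
          linear_combination h4
        have hk0 : (a (τ j) k : ℂ) ≠ 0 := fun h => by
          have := key (τ k) k hjk.symm
          rw [h, mul_zero] at this
          exact hτ0 k (by exact_mod_cast this)
        have hrel : (columnSetoid a).r j k := by
          refine ⟨a (τ j) j / a (τ j) k,
            div_ne_zero (hτ0 j) (by exact_mod_cast hk0), fun θ => ?_⟩
          have : (a θ j : ℂ) = a (τ j) j / a (τ j) k * a θ k := by
            rw [key θ j rfl, key θ k hjk.symm]
            field_simp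
          exact_mod_cast this
        have hmk : m j = m k := congrArg Quotient.out (Quotient.sound (s := columnSetoid a) hrel)
        exact congrArg Nat.cast hmk
      exact ⟨Function.extend g (fun k => (m k : ℝ)) 0, fun k => (hfac.extend_apply 0 k).symm⟩
end

section
/- Let H be a separable complex Hilbert space, (e_k)_{k∈ℕ} pairwise orthogonal orthogonal projections summing strongly to the identity, and α : B(H) → B(H) a positive linear contraction whose range is contained in the von Neumann algebra N generated by (e_k), i.e., for every x ∈ B(H) there is a bounded sequence (c_k) in ℂ with α(x)ξ = ∑_k c_k e_k ξ for all ξ ∈ H. If φ and ψ are α-invariant unit vectors (⟨α(x)φ, φ⟩ = ⟨xφ, φ⟩ and ⟨α(x)ψ, ψ⟩ = ⟨xψ, ψ⟩ for all x ∈ B(H)) which determine different vector states (ψ is not of the form cφ with |c| = 1), then ⟨φ, ψ⟩ = 0. -/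
open scoped InnerProductSpace

section

variable {H : Type*} [NormedAddCommGroup H] [InnerProductSpace ℂ H]

/-- A contraction `T` with `⟪φ, T φ⟫ = 1` at a unit vector `φ` fixes `φ`. -/
theorem apply_eq_self_of_inner_eq_one {T : H →L[ℂ] H} (hT : ‖T‖ ≤ 1) {φ : H} (hφ : ‖φ‖ = 1)
    (h : ⟪φ, T φ⟫_ℂ = 1) : T φ = φ := by
  have hle : ‖T φ‖ ≤ 1 := by simpa [hφ] using T.le_of_opNorm_le hT φ
  have hsq : ‖φ - T φ‖ ^ 2 = 1 - 2 * 1 + ‖T φ‖ ^ 2 := by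
    rw [@norm_sub_sq ℂ, h, hφ]
    simp
  have hzero : ‖φ - T φ‖ ^ 2 = 0 := by
    nlinarith [norm_nonneg (T φ), sq_nonneg ‖φ - T φ‖]
  exact (sub_eq_zero.mp (norm_eq_zero.mp (pow_eq_zero_iff two_ne_zero |>.mp hzero))).symm

/-- The projection onto the line spanned by a unit vector `φ`. -/
noncomputable def lineProj (φ : H) : H →L[ℂ] H := (innerSL ℂ φ).smulRight φ

@[simp]
theorem lineProj_apply (φ x : H) : lineProj φ x = ⟪φ, x⟫_ℂ • φ := rfl

theorem norm_lineProj {φ : H} (hφ : ‖φ‖ = 1) : ‖lineProj φ‖ = 1 := by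
  simp [lineProj, ContinuousLinearMap.norm_smulRight_apply, hφ]

theorem norm_lineProj_add_lineProj_le {φ ψ : H} (hφ : ‖φ‖ = 1) (hψ : ‖ψ‖ = 1) :
    ‖lineProj φ + lineProj ψ‖ ≤ 1 + ‖⟪φ, ψ⟫_ℂ‖ := by
  refine ContinuousLinearMap.opNorm_le_bound _ (by positivity) fun x => ?_
  set y := (lineProj φ + lineProj ψ) x with hy
  have hy' : y = ⟪φ, x⟫_ℂ • φ + ⟪ψ, x⟫_ℂ • ψ := rfl
  set s : ℝ := ‖⟪φ, x⟫_ℂ‖ ^ 2 + ‖⟪ψ, x⟫_ℂ‖ ^ 2 with hs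
  have hnorm : ‖y‖ ^ 2 ≤ (1 + ‖⟪φ, ψ⟫_ℂ‖) * s := by
    have hre : RCLike.re ⟪⟪φ, x⟫_ℂ • φ, ⟪ψ, x⟫_ℂ • ψ⟫_ℂ ≤
        ‖⟪φ, x⟫_ℂ‖ * ‖⟪ψ, x⟫_ℂ‖ * ‖⟪φ, ψ⟫_ℂ‖ := by
      refine (RCLike.re_le_norm _).trans_eq ?_
      rw [inner_smul_left, inner_smul_right, norm_mul, norm_mul, RCLike.norm_conj, mul_assoc]
    rw [hy', @norm_add_sq ℂ, norm_smul, norm_smul, hφ, hψ]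
    nlinarith [mul_nonneg (norm_nonneg ⟪φ, ψ⟫_ℂ)
      (sq_nonneg (‖⟪φ, x⟫_ℂ‖ - ‖⟪ψ, x⟫_ℂ‖))]
  have hinner : s ≤ ‖x‖ * ‖y‖ := by
    have : ⟪y, x⟫_ℂ = (s : ℂ) := by
      rw [hy', inner_add_left, inner_smul_left, inner_smul_left, RCLike.conj_mul,
        RCLike.conj_mul, hs]
      push_cast
      rfl
    calc s ≤ ‖(s : ℂ)‖ := by rw [Complex.norm_real]; exact le_abs_self s
      _ ≤ ‖x‖ * ‖y‖ := by rw [← this, mul_comm]; exact norm_inner_le_norm y x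
  rcases (norm_nonneg y).eq_or_lt with h0 | h0
  · rw [← h0]; positivity
  · refine le_of_mul_le_mul_right ?_ h0
    calc ‖y‖ * ‖y‖ ≤ (1 + ‖⟪φ, ψ⟫_ℂ‖) * s := by rw [← sq]; exact hnorm
      _ ≤ (1 + ‖⟪φ, ψ⟫_ℂ‖) * (‖x‖ * ‖y‖) := by gcongr
      _ = _ := by ring

/-- Unit vectors whose inner product has norm at least one differ by a phase. -/
theorem exists_phase_of_one_le_norm_inner {φ ψ : H} (hφ : ‖φ‖ = 1) (hψ : ‖ψ‖ = 1)
    (h : 1 ≤ ‖⟪φ, ψ⟫_ℂ‖) : ∃ c : ℂ, ‖c‖ = 1 ∧ ψ = c • φ := by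
  have heq : ‖⟪φ, ψ⟫_ℂ‖ = 1 :=
    le_antisymm (by simpa [hφ, hψ] using norm_inner_le_norm (𝕜 := ℂ) φ ψ) h
  have hφ0 : φ ≠ 0 := by rintro rfl; simp at hφ
  have hψ0 : ψ ≠ 0 := by rintro rfl; simp at hψ
  obtain ⟨c, -, hc⟩ := (norm_inner_eq_norm_iff hφ0 hψ0).mp (by rw [heq, hφ, hψ, one_mul])
  refine ⟨c, ?_, hc⟩
  rwa [hc, norm_smul, hφ, mul_one] at hψ

/-- A strong sum `∑ cₖ eₖ` over orthogonal idempotents acts as the scalar `cⱼ` after `eⱼ`. -/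
theorem proj_apply_eq_smul_of_hasSum {e : ℕ → H →L[ℂ] H} (hidem : ∀ k, e k * e k = e k)
    (horth : ∀ j k, j ≠ k → e j * e k = 0) {T : H →L[ℂ] H} {c : ℕ → ℂ}
    (hT : ∀ ζ : H, HasSum (fun k => c k • e k ζ) (T ζ)) (j : ℕ) (ζ : H) :
    e j (T ζ) = c j • e j ζ := by
  refine ((hT ζ).mapL (e j)).unique ?_
  convert hasSum_single (f := fun k => e j (c k • e k ζ)) j fun k hk => ?_ using 1
  · rw [map_smul, ← mul_apply_eq_comp, hidem]
  · rw [map_smul, ← mul_apply_eq_comp, horth j k hk.symm]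
    simp

/-- A strong sum `∑ cₖ eₖ` over orthogonal idempotents acts as the scalar `cⱼ` on the range
of `eⱼ`. -/
theorem apply_proj_eq_smul_of_hasSum {e : ℕ → H →L[ℂ] H} (hidem : ∀ k, e k * e k = e k)
    (horth : ∀ j k, j ≠ k → e j * e k = 0) {T : H →L[ℂ] H} {c : ℕ → ℂ}
    (hT : ∀ ζ : H, HasSum (fun k => c k • e k ζ) (T ζ)) (j : ℕ) (ζ : H) :
    T (e j ζ) = c j • e j ζ := by
  refine (hT (e j ζ)).unique ?_
  convert hasSum_single (f := fun k => c k • e k (e j ζ)) j fun k hk => ?_ using 1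
  · rw [← mul_apply_eq_comp, hidem]
  · rw [← mul_apply_eq_comp, horth k j hk]
    simp

/-- If a strong sum `∑ cₖ eₖ` over orthogonal idempotents fixes `φ`, it fixes the range of
every `eⱼ` with `eⱼ φ ≠ 0`. -/
theorem apply_proj_eq_self_of_apply_eq_self {e : ℕ → H →L[ℂ] H} (hidem : ∀ k, e k * e k = e k)
    (horth : ∀ j k, j ≠ k → e j * e k = 0) {T : H →L[ℂ] H} {c : ℕ → ℂ}
    (hT : ∀ ζ : H, HasSum (fun k => c k • e k ζ) (T ζ)) {φ : H} (hfix : T φ = φ)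
    {j : ℕ} (hj : e j φ ≠ 0) (ζ : H) : T (e j ζ) = e j ζ := by
  have h := proj_apply_eq_smul_of_hasSum hidem horth hT j φ
  rw [hfix] at h
  have hc : c j = 1 := smul_left_injective ℂ hj (by simpa using h.symm)
  rw [apply_proj_eq_smul_of_hasSum hidem horth hT j ζ, hc, one_smul]

end

/-- Let (eₖ) be pairwise orthogonal projections summing strongly to the
identity on a separable complex Hilbert space, and α a positive linear contraction on
B(H) whose range is contained in the von Neumann algebra generated by the eₖ (every
value of α is a strong sum ∑ₖ cₖ eₖ with (cₖ) bounded).  If φ and ψ are α-invariant unit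
vectors determining different vector states, then φ ⊥ ψ. -/
theorem invariant_states_orthogonal
    {H : Type*} [NormedAddCommGroup H] [InnerProductSpace ℂ H]
    [CompleteSpace H] [TopologicalSpace.SeparableSpace H]
    (e : ℕ → H →L[ℂ] H)
    (hsa : ∀ k, IsSelfAdjoint (e k))
    (hidem : ∀ k, e k * e k = e k)
    (horth : ∀ j k, j ≠ k → e j * e k = 0)
    (hsum : ∀ ξ : H, HasSum (fun k => e k ξ) ξ)
    (α : (H →L[ℂ] H) →ₗ[ℂ] (H →L[ℂ] H))
    (hpos : ∀ x : H →L[ℂ] H, x.IsPositive → (α x).IsPositive)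
    (hcontr : ∀ x : H →L[ℂ] H, ‖α x‖ ≤ ‖x‖)
    (hrange : ∀ x : H →L[ℂ] H, ∃ c : ℕ → ℂ, (∃ M : ℝ, ∀ k, ‖c k‖ ≤ M) ∧
      ∀ ζ : H, HasSum (fun k => c k • e k ζ) (α x ζ))
    (φ ψ : H) (hφ : ‖φ‖ = 1) (hψ : ‖ψ‖ = 1)
    (hφinv : ∀ x : H →L[ℂ] H, ⟪φ, α x φ⟫_ℂ = ⟪φ, x φ⟫_ℂ)
    (hψinv : ∀ x : H →L[ℂ] H, ⟪ψ, α x ψ⟫_ℂ = ⟪ψ, x ψ⟫_ℂ)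
    (hdiff : ¬∃ c : ℂ, ‖c‖ = 1 ∧ ψ = c • φ) :
    ⟪φ, ψ⟫_ℂ = 0 := by
  have hfix : ∀ χ : H, ‖χ‖ = 1 → (∀ x : H →L[ℂ] H, ⟪χ, α x χ⟫_ℂ = ⟪χ, x χ⟫_ℂ) →
      ∀ j, e j χ ≠ 0 → ∀ ζ, α (lineProj χ) (e j ζ) = e j ζ := by
    intro χ hχ hinv j hj ζ
    obtain ⟨c, -, hc⟩ := hrange (lineProj χ)
    refine apply_proj_eq_self_of_apply_eq_self hidem horth hc ?_ hj ζ
    refine apply_eq_self_of_inner_eq_one ((hcontr _).trans (norm_lineProj hχ).le) hχ ?_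
    rw [hinv, lineProj_apply, inner_smul_right, inner_self_eq_norm_sq_to_K, hχ]
    simp
  have hdisj : ∀ k, e k φ = 0 ∨ e k ψ = 0 := by
    by_contra! ⟨k, hkφ, hkψ⟩
    refine hdiff (exists_phase_of_one_le_norm_inner hφ hψ ?_)
    have htwo : α (lineProj φ + lineProj ψ) (e k φ) = (2 : ℂ) • e k φ := by
      rw [map_add, add_apply, hfix φ hφ hφinv k hkφ,
        hfix ψ hψ hψinv k hkψ, two_smul]
    have hle := (α (lineProj φ + lineProj ψ)).le_of_opNorm_le
      ((hcontr _).trans (norm_lineProj_add_lineProj_le hφ hψ)) (e k φ)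
    rw [htwo, norm_smul, Complex.norm_ofNat] at hle
    linarith [le_of_mul_le_mul_right hle (norm_pos_iff.mpr hkφ)]
  have hzero : ∀ k, ⟪φ, e k ψ⟫_ℂ = 0 := by
    intro k
    have hmove : ⟪φ, e k ψ⟫_ℂ = ⟪e k φ, e k ψ⟫_ℂ := by
      rw [(hsa k).isSymmetric.apply_clm φ (e k ψ), ← mul_apply_eq_comp, hidem]
    rcases hdisj k with h | h <;> simp [hmove, h]
  have hs := (hsum ψ).mapL (innerSL ℂ φ)
  simp only [innerSL_apply_apply, hzero] at hs
  exact hs.unique hasSum_zero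
end

section
/- Let H be a separable complex Hilbert space, (e_k)_{k∈ℕ} pairwise orthogonal orthogonal projections summing strongly to the identity, and α : B(H) → B(H) a positive linear contraction whose range is contained in the von Neumann algebra N generated by (e_k). Suppose (φ_n)_{n∈I} (I a countable index set) is a family of pairwise orthogonal α-invariant unit vectors whose closed linear span is all of H (a faithful family of states). Then α is the conditional expectation determined by (φ_n): for every x ∈ B(H) and every ξ ∈ H, α(x)ξ = ∑_n ⟨xφ_n, φ_n⟩ ⟨ξ, φ_n⟩ φ_n; in other words α(x) = ∑_n ⟨xφ_n, φ_n⟩ P_{[φ_n]} (strong sum). -/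
open scoped InnerProductSpace

namespace ContinuousLinearMap

variable {H : Type*} [NormedAddCommGroup H] [InnerProductSpace ℂ H]

/-- A positive operator annihilates every vector on which its quadratic form vanishes. -/
lemma IsPositive.apply_eq_zero_of_inner_eq_zero [CompleteSpace H] {T : H →L[ℂ] H}
    (hT : T.IsPositive) {v : H} (hv : ⟪v, T v⟫_ℂ = 0) : T v = 0 := by
  obtain ⟨S, rfl⟩ :=
    CStarAlgebra.nonneg_iff_eq_star_mul_self.mp ((nonneg_iff_isPositive T).mpr hT)
  rw [mul_def, comp_apply, star_eq_adjoint, adjoint_inner_right, inner_self_eq_zero] at hv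
  rw [mul_def, comp_apply, hv, map_zero]

/-- A vector on which a contraction attains the maximal value of its quadratic form is fixed. -/
lemma apply_eq_self_of_inner_eq_one {T : H →L[ℂ] H} (hT : ‖T‖ ≤ 1) {v : H} (hv : ‖v‖ = 1)
    (h : ⟪v, T v⟫_ℂ = 1) : T v = v := by
  have hle : ‖T v‖ ≤ 1 := by simpa [hv] using T.le_of_opNorm_le hT v
  have hsq : ‖v - T v‖ ^ 2 = 1 - 2 + ‖T v‖ ^ 2 := by
    rw [norm_sub_sq (𝕜 := ℂ), h, hv]
    simp
  have hzero : ‖v - T v‖ = 0 := by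
    nlinarith [norm_nonneg (T v), norm_nonneg (v - T v)]
  exact (sub_eq_zero.mp (norm_eq_zero.mp hzero)).symm

/-- Strong sums of multiples of pairwise orthogonal operators commute. -/
lemma commute_of_hasSum_smul {ι : Type*} {e : ι → H →L[ℂ] H}
    (horth : ∀ j k, j ≠ k → e j * e k = 0)
    {S T : H →L[ℂ] H} {c d : ι → ℂ} (hS : ∀ ζ, HasSum (fun k => c k • e k ζ) (S ζ))
    (hT : ∀ ζ, HasSum (fun k => d k • e k ζ) (T ζ)) : Commute S T := by
  have hcomp (j k : ι) (hjk : j ≠ k) (ζ : H) : e j (e k ζ) = 0 := by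
    rw [← comp_apply, ← mul_def, horth j k hjk, zero_apply]
  have hcomm (j : ι) (ζ : H) : e j (T ζ) = T (e j ζ) := by
    have hleft : HasSum (fun k => e j (d k • e k ζ)) (e j (d j • e j ζ)) :=
      hasSum_single j fun k hk => by rw [map_smul, hcomp j k hk.symm, smul_zero]
    have hright : HasSum (fun k => d k • e k (e j ζ)) (d j • e j (e j ζ)) :=
      hasSum_single j fun k hk => by rw [hcomp k j hk, smul_zero]
    rw [((e j).hasSum (hT ζ)).unique hleft, (hT (e j ζ)).unique hright, map_smul]
  ext ζ
  refine (hS (T ζ)).unique ?_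
  simpa only [map_smul, hcomm, mul_def, comp_apply] using T.hasSum (hS ζ)

end ContinuousLinearMap

/-- With (eₖ) pairwise orthogonal projections summing strongly to the
identity and α a positive linear contraction on B(H) with range in the von Neumann
algebra generated by the eₖ: if (φₙ)ₙ∈I is a countable family of pairwise orthogonal
α-invariant unit vectors whose closed linear span is all of H, then α is the
conditional expectation α(x) = ∑ₙ ⟨xφₙ, φₙ⟩ P_{[φₙ]} (strong sum). -/
theorem faithful_invariant_family_conditional_expectation
    {H : Type*} [NormedAddCommGroup H] [InnerProductSpace ℂ H]
    [CompleteSpace H] [TopologicalSpace.SeparableSpace H]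
    (e : ℕ → H →L[ℂ] H)
    (hsa : ∀ k, IsSelfAdjoint (e k))
    (hidem : ∀ k, e k * e k = e k)
    (horth : ∀ j k, j ≠ k → e j * e k = 0)
    (hsum : ∀ ξ : H, HasSum (fun k => e k ξ) ξ)
    (α : (H →L[ℂ] H) →ₗ[ℂ] (H →L[ℂ] H))
    (hpos : ∀ x : H →L[ℂ] H, x.IsPositive → (α x).IsPositive)
    (hcontr : ∀ x : H →L[ℂ] H, ‖α x‖ ≤ ‖x‖)
    (hrange : ∀ x : H →L[ℂ] H, ∃ c : ℕ → ℂ, (∃ M : ℝ, ∀ k, ‖c k‖ ≤ M) ∧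
      ∀ ζ : H, HasSum (fun k => c k • e k ζ) (α x ζ))
    {I : Type*} [Countable I] (φ : I → H)
    (hφ : ∀ n, ‖φ n‖ = 1)
    (hortho : ∀ n m : I, n ≠ m → ⟪φ n, φ m⟫_ℂ = 0)
    (hinv : ∀ (n : I) (x : H →L[ℂ] H), ⟪φ n, α x (φ n)⟫_ℂ = ⟪φ n, x (φ n)⟫_ℂ)
    (hfaithful : (Submodule.span ℂ (Set.range φ)).topologicalClosure = ⊤) :
    ∀ (x : H →L[ℂ] H) (ξ : H),
      HasSum (fun n : I => (⟪φ n, x (φ n)⟫_ℂ * ⟪φ n, ξ⟫_ℂ) • φ n) (α x ξ) := by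
  intro x ξ
  have horthonormal : Orthonormal ℂ φ := ⟨hφ, fun n m h => hortho n m h⟩
  have hself (n : I) : ⟪φ n, φ n⟫_ℂ = 1 := by simp [inner_self_eq_norm_sq_to_K, hφ]
  have hproj (m : I) : α (InnerProductSpace.rankOne ℂ (φ m) (φ m)) =
      InnerProductSpace.rankOne ℂ (φ m) (φ m) := by
    refine ContinuousLinearMap.ext_on
      (Submodule.dense_iff_topologicalClosure_eq_top.mpr hfaithful) ?_
    rintro _ ⟨n, rfl⟩
    rw [InnerProductSpace.rankOne_apply]
    by_cases hnm : n = m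
    · subst hnm
      rw [hself, one_smul]
      refine ContinuousLinearMap.apply_eq_self_of_inner_eq_one ?_ (hφ n) ?_
      · exact (hcontr _).trans (by simp [hφ])
      · simp [hinv, hφ]
    · rw [hortho m n (Ne.symm hnm), zero_smul]
      refine (hpos _ (InnerProductSpace.isPositive_rankOne_self _)).apply_eq_zero_of_inner_eq_zero ?_
      simp [hinv, hortho m n (Ne.symm hnm)]
  have heigen (m : I) : α x (φ m) = ⟪φ m, x (φ m)⟫_ℂ • φ m := by
    obtain ⟨c, -, hc⟩ := hrange x
    obtain ⟨d, -, hd⟩ := hrange (InnerProductSpace.rankOne ℂ (φ m) (φ m))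
    rw [hproj] at hd
    have hcomm := ContinuousLinearMap.commute_of_hasSum_smul horth hc hd
    simpa [hφ, hinv] using DFunLike.congr_fun hcomm.eq (φ m)
  let b := HilbertBasis.mk horthonormal hfaithful.ge
  have hb : ⇑b = φ := HilbertBasis.coe_mk horthonormal hfaithful.ge
  simpa only [map_smul, b.repr_apply_apply, hb, heigen, smul_smul, mul_comm] using
    (α x).hasSum (b.hasSum_repr ξ)
end
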